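/- arXiv:1502.02842 — 7 statements merged into one kernel-verified Lean document; each statement's English description precedes it below -/
import Mathlib

section
/- Let n ≥ 1 and let M be a real symmetric n×n matrix. Then M belongs to the dual cone CS+^{n*} if and only if Σ_{i,j=1}^n M_{ij} Tr(X_i X_j) ≥ 0 for every d ≥ 1 and every tuple (X_1,…,X_n) of real symmetric positive semidefinite d×d matrices with Σ_{i=1}^n Tr(X_i) = 1 all of whose entries are rational. -/
open Matrix

/-- The completely positive semidefinite cone `CS+^n`: real symmetric `n×n` matrices admitting a
Gram representation by positive semidefinite `d×d` matrices for some `d ≥ 1`. -/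
def IsCSPlus {n : ℕ} (A : Matrix (Fin n) (Fin n) ℝ) : Prop :=
  ∃ d : ℕ, 1 ≤ d ∧ ∃ X : Fin n → Matrix (Fin d) (Fin d) ℝ,
    (∀ i, (X i).PosSemidef) ∧ ∀ i j, A i j = (X i * X j).trace

/-- A real number is rational. -/
def IsRat (x : ℝ) : Prop := ∃ q : ℚ, x = (q : ℝ)

open scoped MatrixOrder Matrix.Norms.L2Operator in
/-- A real positive semidefinite matrix is a Gram matrix. -/
theorem Matrix.PosSemidef.exists_eq_conjTranspose_mul_self {m : Type*} [Fintype m]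
    {A : Matrix m m ℝ} (hA : A.PosSemidef) : ∃ B : Matrix m m ℝ, A = Bᴴ * B := by
  classical
  exact CStarAlgebra.nonneg_iff_eq_star_mul_self.mp hA.nonneg

/-- Families of real matrices with rational entries are dense. -/
theorem denseRange_map_ratCast (ι m k : Type*) :
    DenseRange fun (Q : ι → Matrix m k ℚ) (i : ι) => (Q i).map ((↑) : ℚ → ℝ) :=
  DenseRange.piMap fun _ : ι => DenseRange.piMap fun _ : m => DenseRange.piMap fun _ : k =>
    Rat.denseRange_cast (𝕜 := ℝ)

/-- Nonnegativity of the trace form on rational tuples of trace one extends to all rational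
tuples, by scaling. -/
theorem trace_form_nonneg_of_rat {n d : ℕ} {M : Matrix (Fin n) (Fin n) ℝ}
    (h : ∀ X : Fin n → Matrix (Fin d) (Fin d) ℝ,
      (∀ i, (X i).PosSemidef) → (∑ i, (X i).trace) = 1 →
      (∀ i k l, IsRat (X i k l)) → 0 ≤ ∑ i, ∑ j, M i j * (X i * X j).trace)
    {X : Fin n → Matrix (Fin d) (Fin d) ℝ} (hX : ∀ i, (X i).PosSemidef)
    (hrat : ∀ i k l, IsRat (X i k l)) :
    0 ≤ ∑ i, ∑ j, M i j * (X i * X j).trace := by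
  set t := ∑ i, (X i).trace with ht
  have htr : ∀ i, 0 ≤ (X i).trace := fun i => (hX i).trace_nonneg
  have ht_nonneg : 0 ≤ t := Finset.sum_nonneg fun i _ => htr i
  rcases ht_nonneg.eq_or_lt with h0 | hpos
  · have hzero : ∀ i, X i = 0 := fun i => (hX i).trace_eq_zero_iff.mp <|
      (Finset.sum_eq_zero_iff_of_nonneg fun i _ => htr i).mp h0.symm i (Finset.mem_univ i)
    simp [hzero]
  · have htrat : IsRat t := by
      choose q hq using hrat
      exact ⟨∑ i, ∑ k, q i k k, by simp [ht, Matrix.trace, hq]⟩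
    have hscaled := h (fun i => t⁻¹ • X i) (fun i => (hX i).smul (inv_nonneg.mpr hpos.le))
      (by simp only [trace_smul, smul_eq_mul, ← Finset.mul_sum, ← ht]
          exact inv_mul_cancel₀ hpos.ne')
      (fun i k l => by
        obtain ⟨q, hq⟩ := hrat i k l
        obtain ⟨r, hr⟩ := htrat
        exact ⟨r⁻¹ * q, by simp [hq, hr]⟩)
    have hform : ∑ i, ∑ j, M i j * (X i * X j).trace =
        t ^ 2 * ∑ i, ∑ j, M i j * ((t⁻¹ • X i) * (t⁻¹ • X j)).trace := by
      simp only [Finset.mul_sum, Matrix.smul_mul, Matrix.mul_smul, trace_smul, smul_eq_mul]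
      refine Finset.sum_congr rfl fun i _ => Finset.sum_congr rfl fun j _ => ?_
      field_simp
    rw [hform]
    positivity

/-- Nonnegativity of the trace form on rational positive semidefinite tuples of trace one extends
to all positive semidefinite tuples, by density of the rational Gram factors. -/
theorem trace_form_nonneg_of_posSemidef {n d : ℕ} {M : Matrix (Fin n) (Fin n) ℝ}
    (h : ∀ X : Fin n → Matrix (Fin d) (Fin d) ℝ,
      (∀ i, (X i).PosSemidef) → (∑ i, (X i).trace) = 1 →
      (∀ i k l, IsRat (X i k l)) → 0 ≤ ∑ i, ∑ j, M i j * (X i * X j).trace)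
    {X : Fin n → Matrix (Fin d) (Fin d) ℝ} (hX : ∀ i, (X i).PosSemidef) :
    0 ≤ ∑ i, ∑ j, M i j * (X i * X j).trace := by
  choose B hB using fun i => (hX i).exists_eq_conjTranspose_mul_self
  obtain rfl : X = fun i => (B i)ᴴ * B i := funext hB
  clear hX hB
  induction B using (denseRange_map_ratCast (Fin n) (Fin d) (Fin d)).induction_on with
  | hp => exact isClosed_le (by fun_prop) (by fun_prop)
  | ih Q =>
    refine trace_form_nonneg_of_rat h (fun i => posSemidef_conjTranspose_mul_self _)
      fun i k l => ⟨((Q i)ᵀ * Q i) k l, ?_⟩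
    simp [Matrix.mul_apply]

/-- A symmetric matrix `M` is in the dual cone `CS+^{n*}` iff the associated quadratic trace form
is nonnegative on all rational tuples in the matricial simplex. -/
theorem stmt0 (n : ℕ) (hn : 1 ≤ n) (M : Matrix (Fin n) (Fin n) ℝ) (hM : M.IsSymm) :
    (∀ A : Matrix (Fin n) (Fin n) ℝ, IsCSPlus A → 0 ≤ (A * M).trace) ↔
    (∀ d : ℕ, 1 ≤ d → ∀ X : Fin n → Matrix (Fin d) (Fin d) ℝ,
      (∀ i, (X i).PosSemidef) → (∑ i, (X i).trace) = 1 →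
      (∀ i k l, IsRat (X i k l)) →
      0 ≤ ∑ i, ∑ j, M i j * (X i * X j).trace) := by
  have htrace : ∀ A : Matrix (Fin n) (Fin n) ℝ,
      (A * M).trace = ∑ i, ∑ j, M i j * A i j := fun A => by
    simp only [Matrix.trace, Matrix.diag, Matrix.mul_apply]
    exact Finset.sum_congr rfl fun i _ => Finset.sum_congr rfl fun j _ => by
      rw [hM.apply i j, mul_comm]
  constructor
  · intro h d hd X hX _ _
    have hA := h (Matrix.of fun i j => (X i * X j).trace) ⟨d, hd, X, hX, fun _ _ => rfl⟩
    simpa only [htrace, Matrix.of_apply] using hA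
  · rintro h A ⟨d, hd, X, hX, hA⟩
    simp only [htrace, hA]
    exact trace_form_nonneg_of_posSemidef (h d hd) hX
end

section
/- Let n ≥ 1 and let M be a real symmetric n×n matrix. Then M belongs to the dual cone CS+^{n*} if and only if Σ_{i,j=1}^n M_{ij} Tr(X_i X_j) ≥ 0 for every d ≥ 1 and every tuple (X_1,…,X_n) of real symmetric positive definite d×d matrices with Σ_{i=1}^n Tr(X_i) = 1 all of whose entries are rational. -/
open Matrix

/-- Real matrix tuples with rational entries are dense. -/
theorem denseRange_ratCast_matrix_tuple (n d : ℕ) :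
    DenseRange (fun (B : Fin n → Fin d → Fin d → ℚ) (i : Fin n) =>
      (Matrix.of fun k l => (B i k l : ℝ))) :=
  DenseRange.piMap (X := fun _ : Fin n => Fin d → Fin d → ℚ)
    (Y := fun _ : Fin n => Fin d → Fin d → ℝ) fun _ =>
    DenseRange.piMap (X := fun _ : Fin d => Fin d → ℚ) (Y := fun _ : Fin d => Fin d → ℝ) fun _ =>
      DenseRange.piMap (X := fun _ : Fin d => ℚ) (Y := fun _ : Fin d => ℝ) fun _ =>
        Rat.denseRange_cast

/-- Nonnegativity of the trace form on rational positive definite tuples of total trace one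
extends to all rational positive definite tuples. -/
theorem traceForm_nonneg_of_rational_posDef {n : ℕ} (hn : 1 ≤ n) {M : Matrix (Fin n) (Fin n) ℝ}
    {d : ℕ} (hd : 1 ≤ d)
    (h : ∀ X : Fin n → Matrix (Fin d) (Fin d) ℝ,
      (∀ i, (X i).PosDef) → (∑ i, (X i).trace) = 1 → (∀ i k l, IsRat (X i k l)) →
      0 ≤ ∑ i, ∑ j, M i j * (X i * X j).trace)
    (Y : Fin n → Matrix (Fin d) (Fin d) ℚ)
    (hY : ∀ i, ((Y i).map (Rat.cast : ℚ → ℝ)).PosDef) :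
    0 ≤ ∑ i, ∑ j, M i j *
      ((Y i).map (Rat.cast : ℚ → ℝ) * (Y j).map (Rat.cast : ℚ → ℝ)).trace := by
  have : Nonempty (Fin n) := ⟨⟨0, hn⟩⟩
  have : Nonempty (Fin d) := ⟨⟨0, hd⟩⟩
  set t : ℚ := ∑ i, (Y i).trace with ht
  have hcast : (t : ℝ) = ∑ i, ((Y i).map (Rat.cast : ℚ → ℝ)).trace := by
    simp [ht, Matrix.trace]
  have hpos : (0 : ℝ) < t := by
    rw [hcast]
    exact Finset.sum_pos (fun i _ => (hY i).trace_pos) Finset.univ_nonempty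
  have key := h (fun i => (t : ℝ)⁻¹ • (Y i).map (Rat.cast : ℚ → ℝ))
    (fun i => (hY i).smul (inv_pos.2 hpos))
    (by simp only [Matrix.trace_smul, smul_eq_mul]
        rw [← Finset.mul_sum, ← hcast, inv_mul_cancel₀ hpos.ne'])
    (fun i k l => ⟨t⁻¹ * Y i k l, by simp⟩)
  have hscale : ∑ i, ∑ j, M i j * (((t : ℝ)⁻¹ • (Y i).map (Rat.cast : ℚ → ℝ)) *
        ((t : ℝ)⁻¹ • (Y j).map (Rat.cast : ℚ → ℝ))).trace =
      ((t : ℝ)⁻¹ * (t : ℝ)⁻¹) * ∑ i, ∑ j, M i j *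
        ((Y i).map (Rat.cast : ℚ → ℝ) * (Y j).map (Rat.cast : ℚ → ℝ)).trace := by
    simp only [Matrix.smul_mul, Matrix.mul_smul, Matrix.trace_smul, smul_eq_mul, Finset.mul_sum]
    refine Finset.sum_congr rfl fun i _ => Finset.sum_congr rfl fun j _ => by ring
  rw [hscale] at key
  exact nonneg_of_mul_nonneg_right key (mul_pos (inv_pos.2 hpos) (inv_pos.2 hpos))

open scoped MatrixOrder in
/-- A real positive semidefinite matrix is a Gram matrix `Bᵀ * B`. -/
theorem exists_eq_transpose_mul_self {d : ℕ} {A : Matrix (Fin d) (Fin d) ℝ}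
    (hA : A.PosSemidef) : ∃ B : Matrix (Fin d) (Fin d) ℝ, A = Bᵀ * B := by
  obtain ⟨B, hB⟩ := CStarAlgebra.nonneg_iff_eq_star_mul_self.1 hA.nonneg
  exact ⟨B, by simpa [Matrix.star_eq_conjTranspose] using hB⟩

/-- Nonnegativity of the trace form on rational positive definite tuples of total trace one
extends to all positive semidefinite tuples. -/
theorem traceForm_nonneg_of_posSemidef {n : ℕ} (hn : 1 ≤ n) {M : Matrix (Fin n) (Fin n) ℝ}
    {d : ℕ} (hd : 1 ≤ d)
    (h : ∀ X : Fin n → Matrix (Fin d) (Fin d) ℝ,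
      (∀ i, (X i).PosDef) → (∑ i, (X i).trace) = 1 → (∀ i k l, IsRat (X i k l)) →
      0 ≤ ∑ i, ∑ j, M i j * (X i * X j).trace)
    (X : Fin n → Matrix (Fin d) (Fin d) ℝ) (hX : ∀ i, (X i).PosSemidef) :
    0 ≤ ∑ i, ∑ j, M i j * (X i * X j).trace := by
  choose B hB using fun i => exists_eq_transpose_mul_self (hX i)
  let F : (Fin n → Matrix (Fin d) (Fin d) ℝ) → ℝ → ℝ := fun C ε =>
    ∑ i, ∑ j, M i j * (((C i)ᵀ * C i + ε • 1) * ((C j)ᵀ * C j + ε • 1)).trace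
  have hF : ∀ (q : ℚ), 0 < q → ∀ C, 0 ≤ F C q := by
    intro q hq C
    refine (denseRange_ratCast_matrix_tuple n d).induction_on
      (p := fun C : Fin n → Matrix (Fin d) (Fin d) ℝ => 0 ≤ F C q) C
      (isClosed_le continuous_const (by fun_prop)) fun R => ?_
    have hmap : ∀ i, (((Matrix.of (R i))ᵀ * Matrix.of (R i) + q • 1).map (Rat.cast : ℚ → ℝ)) =
        (Matrix.of fun k l => (R i k l : ℝ))ᵀ * (Matrix.of fun k l => (R i k l : ℝ)) +
          (q : ℝ) • 1 := by
      intro i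
      ext k l
      simp [Matrix.mul_apply, Matrix.one_apply, apply_ite (Rat.cast : ℚ → ℝ)]
    have := traceForm_nonneg_of_rational_posDef hn hd h
      (fun i => (Matrix.of (R i))ᵀ * Matrix.of (R i) + q • 1) fun i => by
        rw [hmap]
        refine Matrix.PosDef.posSemidef_add ?_ (Matrix.PosDef.one.smul (by exact_mod_cast hq))
        simpa using Matrix.posSemidef_conjTranspose_mul_self
          (Matrix.of fun k l => (R i k l : ℝ))
    simpa only [hmap] using this
  have hcont : Continuous (F B) := by fun_prop
  have hlim := (hcont.tendsto 0).comp (tendsto_one_div_add_atTop_nhds_zero_nat (𝕜 := ℝ))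
  have hzero : F B 0 = ∑ i, ∑ j, M i j * (X i * X j).trace := by simp [F, hB]
  rw [← hzero]
  refine ge_of_tendsto' hlim fun k => ?_
  simpa using hF (1 / ((k : ℚ) + 1)) (by positivity) B

/-- A symmetric matrix `M` is in the dual cone `CS+^{n*}` iff the associated quadratic trace form
is nonnegative on all rational tuples in the matricial simplex. -/
theorem stmt1 (n : ℕ) (hn : 1 ≤ n) (M : Matrix (Fin n) (Fin n) ℝ) (hM : M.IsSymm) :
    (∀ A : Matrix (Fin n) (Fin n) ℝ, IsCSPlus A → 0 ≤ (A * M).trace) ↔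
    (∀ d : ℕ, 1 ≤ d → ∀ X : Fin n → Matrix (Fin d) (Fin d) ℝ,
      (∀ i, (X i).PosDef) → (∑ i, (X i).trace) = 1 →
      (∀ i k l, IsRat (X i k l)) →
      0 ≤ ∑ i, ∑ j, M i j * (X i * X j).trace) := by
  have hpair : ∀ {d : ℕ} (A : Matrix (Fin n) (Fin n) ℝ) (X : Fin n → Matrix (Fin d) (Fin d) ℝ),
      (∀ i j, A i j = (X i * X j).trace) →
      (A * M).trace = ∑ i, ∑ j, M i j * (X i * X j).trace := by
    intro d A X hA
    simp only [Matrix.trace, Matrix.diag_apply, Matrix.mul_apply] at hA ⊢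
    refine Finset.sum_congr rfl fun i _ => Finset.sum_congr rfl fun j _ => ?_
    rw [hA, hM.apply, mul_comm]
  constructor
  · intro h d hd X hX _ _
    rw [← hpair (Matrix.of fun i j => (X i * X j).trace) X fun _ _ => rfl]
    exact h _ ⟨d, hd, X, fun i => (hX i).posSemidef, fun _ _ => rfl⟩
  · rintro h A ⟨d, hd, X, hX, hA⟩
    rw [hpair A X hA]
    exact traceForm_nonneg_of_posSemidef hn hd (h d hd) X hX
end

section
/- Let n, r ≥ 1 and let M be a real symmetric n×n matrix. Then Σ_{i,j=1}^n M_{ij} Tr(X_i X_j) ≥ 0 holds for all (X_1,…,X_n) ∈ Δ(n,r) if and only if it holds for all (X_1,…,X_n) ∈ Δ̲(n,r); that is, D_r^n = {M ∈ S^n : Σ_{i,j=1}^n M_{ij} Tr(X_i X_j) ≥ 0 for all (X_1,…,X_n) ∈ Δ̲(n,r)}. -/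
open Matrix

/-- A real number is rational with denominator at most `r`. -/
def RatDen (r : ℕ) (x : ℝ) : Prop :=
  ∃ (p : ℤ) (q : ℕ), 1 ≤ q ∧ q ≤ r ∧ x = (p : ℝ) / (q : ℝ)

/-- A row of a positive semidefinite matrix whose diagonal entry vanishes is zero. -/
lemma Matrix.PosSemidef.apply_eq_zero_of_diag_eq_zero {ι : Type*} [Fintype ι]
    {A : Matrix ι ι ℝ} (hA : A.PosSemidef) {k : ι} (hk : A k k = 0) (l : ι) : A k l = 0 := by
  have hdet := (hA.submatrix ![k, l]).det_nonneg
  have hsymm : A l k = A k l := by simpa using hA.isHermitian.apply k l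
  simp only [det_fin_two, submatrix_apply, cons_val_zero, cons_val_one, hk, hsymm] at hdet
  nlinarith

/-- Bordering a positive semidefinite matrix with zeros keeps it positive semidefinite. -/
lemma Matrix.PosSemidef.fromBlocks_zero {ι κ : Type*} [Fintype ι] [Fintype κ] [DecidableEq ι]
    {A : Matrix ι ι ℝ} (hA : A.PosSemidef) :
    (fromBlocks A 0 0 (0 : Matrix κ κ ℝ)).PosSemidef := by
  have h := hA.conjTranspose_mul_mul_same (fromCols (1 : Matrix ι ι ℝ) (0 : Matrix ι κ ℝ))
  convert h using 1
  rw [conjTranspose_fromCols_eq_fromRows_conjTranspose, fromRows_mul, fromRows_mul_fromCols]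
  simp

lemma Matrix.trace_fromBlocks {ι κ : Type*} [Fintype ι] [Fintype κ] (A : Matrix ι ι ℝ)
    (B : Matrix ι κ ℝ) (C : Matrix κ ι ℝ) (D : Matrix κ κ ℝ) :
    (fromBlocks A B C D).trace = A.trace + D.trace := by
  simp [trace]

lemma RatDen.zero {r : ℕ} (hr : 1 ≤ r) : RatDen r 0 := ⟨0, 1, le_rfl, hr, by simp⟩

/-- A positive rational with denominator at most `r` is at least `1 / r`. -/
lemma RatDen.one_le_mul {r : ℕ} {x : ℝ} (h : RatDen r x) (hx : 0 < x) : 1 ≤ r * x := by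
  obtain ⟨p, q, hq, hqr, rfl⟩ := h
  have hq0 : (0 : ℝ) < q := by exact_mod_cast hq
  have hp : (1 : ℝ) ≤ p := by
    have : (0 : ℝ) < p := by simpa [div_mul_cancel₀ _ hq0.ne'] using mul_pos hx hq0
    exact_mod_cast this
  have hqr' : (q : ℝ) ≤ r := by exact_mod_cast hqr
  rw [← mul_div_assoc, le_div_iff₀ hq0]
  nlinarith

/-- The set of indices at which some matrix of the tuple has a nonzero diagonal entry. -/
noncomputable def diagSupport {ι κ : Type*} [Fintype κ] (X : ι → Matrix κ κ ℝ) : Finset κ :=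
  open Classical in {k | ∃ i, X i k k ≠ 0}

lemma diag_eq_zero_of_notMem_diagSupport {ι κ : Type*} [Fintype κ] {X : ι → Matrix κ κ ℝ}
    {k : κ} (hk : k ∉ diagSupport X) (i : ι) : X i k k = 0 := by
  simp only [diagSupport, Finset.mem_filter, Finset.mem_univ, true_and, not_exists,
    not_not] at hk
  exact hk i

lemma card_diagSupport_le {ι κ : Type*} [Fintype ι] [Fintype κ] {r : ℕ}
    {X : ι → Matrix κ κ ℝ} (hX : ∀ i, (X i).PosSemidef) (htr : ∑ i, (X i).trace = 1)
    (hrat : ∀ i k l, RatDen r (X i k l)) : (diagSupport X).card ≤ r := by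
  have hone : ∀ k ∈ diagSupport X, (1 : ℝ) ≤ ∑ i, r * X i k k := by
    intro k hk
    simp only [diagSupport, Finset.mem_filter, Finset.mem_univ, true_and] at hk
    obtain ⟨i, hi⟩ := hk
    have hpos : 0 < X i k k := lt_of_le_of_ne (hX i).diag_nonneg hi.symm
    exact ((hrat i k k).one_le_mul hpos).trans
      (Finset.single_le_sum (f := fun i => r * X i k k)
        (fun j _ => mul_nonneg r.cast_nonneg (hX j).diag_nonneg) (Finset.mem_univ i))
  have hle : ((diagSupport X).card : ℝ) ≤ r := calc
    ((diagSupport X).card : ℝ) = ∑ k ∈ diagSupport X, (1 : ℝ) := by simp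
    _ ≤ ∑ k ∈ diagSupport X, ∑ i, r * X i k k := Finset.sum_le_sum hone
    _ ≤ ∑ k, ∑ i, r * X i k k :=
      Finset.sum_le_univ_sum_of_nonneg fun k =>
        Finset.sum_nonneg fun i _ => mul_nonneg r.cast_nonneg (hX i).diag_nonneg
    _ = r * ∑ i, (X i).trace := by
      rw [Finset.sum_comm]
      simp [trace, Finset.mul_sum]
    _ = r := by rw [htr, mul_one]
  exact_mod_cast hle

lemma sum_coe_sort_eq_sum_of_notMem {κ : Type*} [Fintype κ] (S : Finset κ) {f : κ → ℝ}
    (hf : ∀ k ∉ S, f k = 0) : ∑ k : S, f k = ∑ k, f k := by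
  rw [Finset.sum_coe_sort S f]
  exact Finset.sum_subset (Finset.subset_univ S) fun k _ hk => hf k hk

/-- Membership in `D_r^n` can be tested using only tuples of `r×r` matrices (the set `Δ̲(n,r)`)
instead of tuples of `d×d` matrices of arbitrary size `d ≥ 1` (the set `Δ(n,r)`). -/
theorem stmt2 (n r : ℕ) (hn : 1 ≤ n) (hr : 1 ≤ r)
    (M : Matrix (Fin n) (Fin n) ℝ) (hM : M.IsSymm) :
    (∀ d : ℕ, 1 ≤ d → ∀ X : Fin n → Matrix (Fin d) (Fin d) ℝ,
      (∀ i, (X i).PosSemidef) → (∑ i, (X i).trace) = 1 →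
      (∀ i k l, RatDen r (X i k l)) →
      0 ≤ ∑ i, ∑ j, M i j * (X i * X j).trace) ↔
    (∀ X : Fin n → Matrix (Fin r) (Fin r) ℝ,
      (∀ i, (X i).PosSemidef) → (∑ i, (X i).trace) = 1 →
      (∀ i k l, RatDen r (X i k l)) →
      0 ≤ ∑ i, ∑ j, M i j * (X i * X j).trace) := by
  refine ⟨fun h => h r hr, fun h d _ X hX htr hrat => ?_⟩
  set S := diagSupport X
  have hcard : S.card ≤ r := card_diagSupport_le hX htr hrat
  have hrow : ∀ k ∉ S, ∀ i l, X i k l = 0 := fun k hk i l =>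
    (hX i).apply_eq_zero_of_diag_eq_zero (diag_eq_zero_of_notMem_diagSupport hk i) l
  have hcol : ∀ l ∉ S, ∀ i k, X i k l = 0 := fun l hl i k => by
    have hsymm : X i l k = X i k l := by simpa using (hX i).isHermitian.apply k l
    rw [← hsymm, hrow l hl]
  let e : Fin r ≃ S ⊕ Fin (r - S.card) := Fintype.equivOfCardEq (by simp; omega)
  let Z : Fin n → Matrix S S ℝ := fun i => (X i).submatrix (↑) (↑)
  let B : Fin n → Matrix (S ⊕ Fin (r - S.card)) (S ⊕ Fin (r - S.card)) ℝ :=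
    fun i => fromBlocks (Z i) 0 0 0
  have htrace_reindex : ∀ A : Matrix (S ⊕ Fin (r - S.card)) (S ⊕ Fin (r - S.card)) ℝ,
      (A.submatrix e e).trace = A.trace := fun A => e.sum_comp fun k => A k k
  have htrace : ∀ i, (B i).trace = (X i).trace := fun i => by
    rw [trace_fromBlocks, trace_zero, add_zero]
    exact sum_coe_sort_eq_sum_of_notMem S fun k hk => hrow k hk i k
  have hmul : ∀ i j, (B i * B j).trace = (X i * X j).trace := fun i j => by
    simp only [B, fromBlocks_multiply, trace_fromBlocks, Matrix.mul_zero, add_zero,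
      trace_zero]
    have hentry : ∀ k l : S, (Z i * Z j) k l = (X i * X j) k l := fun k l =>
      sum_coe_sort_eq_sum_of_notMem S (f := fun m => X i k m * X j m l) fun m hm => by
        rw [hcol m hm, zero_mul]
    simp only [trace, diag_apply, hentry]
    exact sum_coe_sort_eq_sum_of_notMem S (f := fun k => (X i * X j) k k) fun k hk => by
      simp [mul_apply, hrow k hk]
  have key := h (fun i => (B i).submatrix e e)
    (fun i => ((hX i).submatrix _).fromBlocks_zero.submatrix e)
    (by simpa only [htrace_reindex, htrace] using htr)
    (fun i a b => by
      rw [submatrix_apply]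
      rcases e a with k | k <;> rcases e b with l | l
      · exact hrat i k l
      all_goals exact RatDen.zero hr)
  simpa only [submatrix_mul_equiv, htrace_reindex, hmul] using key
end

section
/- For all integers n, r ≥ 1, the cone D_r^n is polyhedral: there exists a finite set S of real symmetric n×n matrices such that D_r^n = {M ∈ S^n : Tr(AM) ≥ 0 for all A ∈ S}. -/
open Matrix

/-- Membership in the cone `D_r^n`: the quadratic trace form of `M` is nonnegative on all tuples
in `Δ(n,r)`, i.e. tuples of psd `d×d` matrices (any `d ≥ 1`) with total trace one and entries
rational with denominator at most `r`. -/
def InD (n r : ℕ) (M : Matrix (Fin n) (Fin n) ℝ) : Prop :=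
  ∀ d : ℕ, 1 ≤ d → ∀ X : Fin n → Matrix (Fin d) (Fin d) ℝ,
    (∀ i, (X i).PosSemidef) → (∑ i, (X i).trace) = 1 →
    (∀ i k l, RatDen r (X i k l)) →
    0 ≤ ∑ i, ∑ j, M i j * (X i * X j).trace

/-- The Gram matrices `(Tr (X i * X j))` of the tuples `X` in `Δ(n,r)`. -/
def gramSet (n r : ℕ) : Set (Matrix (Fin n) (Fin n) ℝ) :=
  {G | ∃ d : ℕ, 1 ≤ d ∧ ∃ X : Fin n → Matrix (Fin d) (Fin d) ℝ,
    (∀ i, (X i).PosSemidef) ∧ (∑ i, (X i).trace) = 1 ∧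
    (∀ i k l, RatDen r (X i k l)) ∧ G = Matrix.of fun i j => (X i * X j).trace}

lemma RatDen.exists_int_factorial_mul {r : ℕ} {x : ℝ} (h : RatDen r x) :
    ∃ m : ℤ, (r.factorial : ℝ) * x = m := by
  obtain ⟨p, q, hq, hqr, rfl⟩ := h
  obtain ⟨c, hc⟩ := Nat.dvd_factorial hq hqr
  have hq0 : (q : ℝ) ≠ 0 := by positivity
  refine ⟨c * p, ?_⟩
  rw [hc]
  push_cast
  field_simp

lemma Matrix.PosSemidef.apply_sq_le {d : ℕ} {X : Matrix (Fin d) (Fin d) ℝ} (hX : X.PosSemidef)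
    (k l : Fin d) : X k l ^ 2 ≤ X k k * X l l := by
  have h := (hX.submatrix ![k, l]).det_nonneg
  have hs : X l k = X k l := by simpa using hX.isHermitian.apply k l
  simp only [det_fin_two, submatrix_apply, cons_val_zero, cons_val_one, hs] at h
  linarith

lemma abs_trace_mul_le_trace_mul_trace {d : ℕ} {X Y : Matrix (Fin d) (Fin d) ℝ}
    (hX : X.PosSemidef) (hY : Y.PosSemidef) : |(X * Y).trace| ≤ X.trace * Y.trace := by
  have entry (k l : Fin d) : |X k l * Y l k| ≤ (X k k * Y l l + X l l * Y k k) / 2 := by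
    have hXk := hX.diag_nonneg (i := k)
    have hXl := hX.diag_nonneg (i := l)
    have hYk := hY.diag_nonneg (i := k)
    have hYl := hY.diag_nonneg (i := l)
    apply abs_le_of_sq_le_sq _ (by positivity)
    have h := mul_le_mul (hX.apply_sq_le k l) (hY.apply_sq_le l k) (sq_nonneg _) (by positivity)
    nlinarith [sq_nonneg (X k k * Y l l - X l l * Y k k)]
  calc |(X * Y).trace| = |∑ k, ∑ l, X k l * Y l k| := by simp [trace, mul_apply]
    _ ≤ ∑ k, ∑ l, |X k l * Y l k| :=
      (Finset.abs_sum_le_sum_abs _ _).trans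
        (Finset.sum_le_sum fun _ _ => Finset.abs_sum_le_sum_abs _ _)
    _ ≤ ∑ k, ∑ l, (X k k * Y l l + X l l * Y k k) / 2 :=
      Finset.sum_le_sum fun k _ => Finset.sum_le_sum fun l _ => entry k l
    _ = X.trace * Y.trace := by
      simp only [← Finset.sum_div, Finset.sum_add_distrib, ← Finset.mul_sum, ← Finset.sum_mul,
        trace, diag_apply]
      ring

lemma gramSet_finite (n r : ℕ) : (gramSet n r).Finite := by
  set N : ℕ := r.factorial with hN
  have hNpos : (0 : ℝ) < N := by exact_mod_cast r.factorial_pos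
  let T : Set ℝ := (fun m : ℤ => (m : ℝ) / (N : ℝ) ^ 2) '' Set.Icc (-(N : ℤ) ^ 2) ((N : ℤ) ^ 2)
  have hT : T.Finite := (Set.finite_Icc _ _).image _
  refine (Set.Finite.pi' (fun _ : Fin n => Set.Finite.pi' fun _ : Fin n => hT)).subset ?_
  rintro G ⟨d, -, X, hpsd, htr, hrat, rfl⟩ i j
  choose m hm using fun i k l => (hrat i k l).exists_int_factorial_mul
  have hle (i : Fin n) : (X i).trace ≤ 1 :=
    htr ▸ Finset.single_le_sum (fun i _ => (hpsd i).trace_nonneg) (Finset.mem_univ i)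
  have hbound : |(X i * X j).trace| ≤ 1 :=
    (abs_trace_mul_le_trace_mul_trace (hpsd i) (hpsd j)).trans
      (mul_le_one₀ (hle i) (hpsd j).trace_nonneg (hle j))
  have hint : (N : ℝ) ^ 2 * (X i * X j).trace = ((∑ k, ∑ l, m i k l * m j l k : ℤ) : ℝ) := by
    push_cast
    simp only [trace, diag_apply, mul_apply, Finset.mul_sum, ← hm]
    refine Finset.sum_congr rfl fun k _ => Finset.sum_congr rfl fun l _ => ?_
    ring
  rw [abs_le] at hbound
  refine ⟨∑ k, ∑ l, m i k l * m j l k, ⟨?_, ?_⟩, ?_⟩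
  · rify
    push_cast at hint
    rw [← hint]
    nlinarith [hbound.1, pow_pos hNpos 2]
  · rify
    push_cast at hint
    rw [← hint]
    nlinarith [hbound.2, pow_pos hNpos 2]
  · simp only [← hint, of_apply]
    field_simp

lemma trace_gram_mul {n d : ℕ} (X : Fin n → Matrix (Fin d) (Fin d) ℝ)
    (M : Matrix (Fin n) (Fin n) ℝ) :
    ((Matrix.of fun i j => (X i * X j).trace) * M).trace =
      ∑ i, ∑ j, M i j * (X i * X j).trace := by
  simp only [trace, diag_apply, mul_apply (N := M), of_apply]
  rw [Finset.sum_comm]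
  refine Finset.sum_congr rfl fun i _ => Finset.sum_congr rfl fun j _ => ?_
  rw [mul_comm]
  congr 1
  exact trace_mul_comm (X j) (X i)

/-- The cone `D_r^n` is polyhedral: it is cut out, inside the space of symmetric matrices, by
finitely many linear inequalities `Tr(AM) ≥ 0`. -/
theorem stmt4 (n r : ℕ) (hn : 1 ≤ n) (hr : 1 ≤ r) :
    ∃ S : Finset (Matrix (Fin n) (Fin n) ℝ), (∀ A ∈ S, A.IsSymm) ∧
      {M : Matrix (Fin n) (Fin n) ℝ | M.IsSymm ∧ InD n r M} =
      {M : Matrix (Fin n) (Fin n) ℝ | M.IsSymm ∧ ∀ A ∈ S, 0 ≤ (A * M).trace} := by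
  refine ⟨(gramSet_finite n r).toFinset, ?_, ?_⟩
  · intro A hA
    obtain ⟨d, -, X, -, -, -, rfl⟩ := (Set.Finite.mem_toFinset _).1 hA
    ext i j
    exact trace_mul_comm (X j) (X i)
  · ext M
    refine and_congr_right fun _ => ⟨fun h A hA => ?_, fun h d hd X hpsd htr hrat => ?_⟩
    · obtain ⟨d, hd, X, hpsd, htr, hrat, rfl⟩ := (Set.Finite.mem_toFinset _).1 hA
      rw [trace_gram_mul]
      exact h d hd X hpsd htr hrat
    · rw [← trace_gram_mul]
      exact h _ ((Set.Finite.mem_toFinset _).2 ⟨d, hd, X, hpsd, htr, hrat, rfl⟩)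
end

section
/- Let n ≥ 1 and let (M_r)_{r ≥ 1} be a sequence of real symmetric n×n matrices converging (entrywise) to a matrix M. If M_r ∈ D_r^n for every r ≥ 1, then M ∈ CS+^{n*}. -/
open Matrix

/-- A rational number has denominator at most `r` for all large `r`. -/
theorem eventually_ratDen (x : ℚ) : ∀ᶠ r in Filter.atTop, RatDen r (x : ℝ) := by
  filter_upwards [Filter.eventually_ge_atTop x.den] with r hr
  exact ⟨x.num, x.den, x.den_pos, hr, Rat.cast_def x⟩

/-- A limit of matrices in `D_r^n` is nonnegative on normalized rational positive semidefinite
tuples. -/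
theorem nonneg_of_tendsto_inD {n : ℕ} {M : ℕ → Matrix (Fin n) (Fin n) ℝ}
    (hmem : ∀ r, 1 ≤ r → InD n r (M r)) {L : Matrix (Fin n) (Fin n) ℝ}
    (hconv : ∀ i j, Filter.Tendsto (fun r => M r i j) Filter.atTop (nhds (L i j)))
    {d : ℕ} (hd : 1 ≤ d) (X : Fin n → Matrix (Fin d) (Fin d) ℝ)
    (hX : ∀ i, (X i).PosSemidef) (htr : ∑ i, (X i).trace = 1)
    (hrat : ∀ i k l, ∃ q : ℚ, X i k l = q) :
    0 ≤ ∑ i, ∑ j, L i j * (X i * X j).trace := by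
  have hden : ∀ᶠ r in Filter.atTop, ∀ i k l, RatDen r (X i k l) := by
    simp only [Filter.eventually_all]
    intro i k l
    obtain ⟨q, hq⟩ := hrat i k l
    simpa only [hq] using eventually_ratDen q
  have hlim : Filter.Tendsto (fun r => ∑ i, ∑ j, M r i j * (X i * X j).trace) Filter.atTop
      (nhds (∑ i, ∑ j, L i j * (X i * X j).trace)) :=
    tendsto_finsetSum _ fun i _ => tendsto_finsetSum _ fun j _ => (hconv i j).mul_const _
  refine ge_of_tendsto hlim ?_
  filter_upwards [hden, Filter.eventually_ge_atTop 1] with r hr h1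
  exact hmem r h1 d hd X hX htr hr

/-- A limit of matrices in `D_r^n` is nonnegative on tuples of Gram matrices of rational
matrices. -/
theorem nonneg_of_tendsto_inD_gram {n : ℕ} {M : ℕ → Matrix (Fin n) (Fin n) ℝ}
    (hmem : ∀ r, 1 ≤ r → InD n r (M r)) {L : Matrix (Fin n) (Fin n) ℝ}
    (hconv : ∀ i j, Filter.Tendsto (fun r => M r i j) Filter.atTop (nhds (L i j)))
    {d : ℕ} (hd : 1 ≤ d) (B : Fin n → Matrix (Fin d) (Fin d) ℝ)
    (hrat : ∀ i k l, ∃ q : ℚ, B i k l = q) :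
    0 ≤ ∑ i, ∑ j, L i j * (((B i)ᴴ * B i) * ((B j)ᴴ * B j)).trace := by
  choose q hq using hrat
  have hpsd : ∀ i, ((B i)ᴴ * B i).PosSemidef := fun i => posSemidef_conjTranspose_mul_self _
  set t : ℝ := ∑ i, ((B i)ᴴ * B i).trace with ht
  have ht0 : 0 ≤ t := Finset.sum_nonneg fun i _ => (hpsd i).trace_nonneg
  rcases ht0.eq_or_lt with h0 | hpos
  · have hzero : ∀ i, (B i)ᴴ * B i = 0 := fun i =>
      (hpsd i).trace_eq_zero_iff.1 <|
        (Finset.sum_eq_zero_iff_of_nonneg fun i _ => (hpsd i).trace_nonneg).1 h0.symm i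
          (Finset.mem_univ i)
    simp only [hzero, mul_zero, trace_zero, Finset.sum_const_zero, le_refl]
  · have key := nonneg_of_tendsto_inD hmem hconv hd (fun i => t⁻¹ • ((B i)ᴴ * B i))
      (fun i => (hpsd i).smul (inv_nonneg.2 ht0))
      (by simp only [trace_smul, smul_eq_mul, ← Finset.mul_sum, ← ht]
          exact inv_mul_cancel₀ hpos.ne')
      (fun i k l => ⟨(∑ i, ∑ a, ∑ b, q i b a * q i b a)⁻¹ * ∑ b, q i b k * q i b l, by
        simp [ht, trace, mul_apply, hq]⟩)
    have hscale : ∑ i, ∑ j, L i j * ((t⁻¹ • ((B i)ᴴ * B i)) * (t⁻¹ • ((B j)ᴴ * B j))).trace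
        = (t⁻¹ * t⁻¹) * ∑ i, ∑ j, L i j * (((B i)ᴴ * B i) * ((B j)ᴴ * B j)).trace := by
      simp only [Finset.mul_sum, smul_mul, Matrix.mul_smul, trace_smul, smul_eq_mul]
      refine Finset.sum_congr rfl fun i _ => Finset.sum_congr rfl fun j _ => ?_
      ring
    rw [hscale] at key
    exact nonneg_of_mul_nonneg_right key (by positivity)

open scoped MatrixOrder in
/-- A real positive semidefinite matrix is a Gram matrix. -/
theorem Matrix.PosSemidef.exists_eq_conjTranspose_mul_self_s6 {d : ℕ}
    {X : Matrix (Fin d) (Fin d) ℝ} (hX : X.PosSemidef) :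
    ∃ B : Matrix (Fin d) (Fin d) ℝ, X = Bᴴ * B :=
  CStarAlgebra.nonneg_iff_eq_star_mul_self.1 hX.nonneg

/-- Tuples of rational matrices are dense among tuples of real matrices. -/
theorem denseRange_ratCast_tuple (n d : ℕ) :
    DenseRange (fun (q : Fin n → Fin d → Fin d → ℚ) (i : Fin n) =>
      (Matrix.of fun k l => (q i k l : ℝ) : Matrix (Fin d) (Fin d) ℝ)) :=
  DenseRange.piMap fun _ => DenseRange.piMap fun _ => DenseRange.piMap fun _ =>
    Rat.denseRange_cast

/-- If symmetric matrices `M_r ∈ D_r^n` converge entrywise to `M`, then `M ∈ CS+^{n*}`. -/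
theorem stmt6 (n : ℕ) (hn : 1 ≤ n) (M : ℕ → Matrix (Fin n) (Fin n) ℝ)
    (hsym : ∀ r, 1 ≤ r → (M r).IsSymm)
    (hmem : ∀ r, 1 ≤ r → InD n r (M r))
    (L : Matrix (Fin n) (Fin n) ℝ)
    (hconv : ∀ i j, Filter.Tendsto (fun r => M r i j) Filter.atTop (nhds (L i j))) :
    L.IsSymm ∧ ∀ A, IsCSPlus A → 0 ≤ (A * L).trace := by
  have hL : L.IsSymm := by
    refine IsSymm.ext fun i j => tendsto_nhds_unique (hconv j i) ((hconv i j).congr' ?_)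
    filter_upwards [Filter.eventually_ge_atTop 1] with r hr
    exact ((hsym r hr).apply i j).symm
  refine ⟨hL, ?_⟩
  rintro A ⟨d, hd, X, hX, hA⟩
  have hgram : ∀ B : Fin n → Matrix (Fin d) (Fin d) ℝ,
      0 ≤ ∑ i, ∑ j, L i j * (((B i)ᴴ * B i) * ((B j)ᴴ * B j)).trace := by
    intro B
    refine (denseRange_ratCast_tuple n d).induction_on B ?_ fun q =>
      nonneg_of_tendsto_inD_gram hmem hconv hd _ fun i k l => ⟨q i k l, rfl⟩
    exact isClosed_le continuous_const (by fun_prop)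
  choose B hB using fun i => (hX i).exists_eq_conjTranspose_mul_self_s6
  have htrace : (A * L).trace = ∑ i, ∑ j, L i j * (X i * X j).trace := by
    simp only [trace, diag_apply, mul_apply (M := A), hA]
    refine Finset.sum_congr rfl fun i _ => Finset.sum_congr rfl fun j _ => ?_
    rw [hL.apply i j, mul_comm]
  rw [htrace]
  simpa only [hB] using hgram B
end

section
/- For every n ≥ 1, the cone C_1^n equals the set of n×n diagonal matrices with nonnegative diagonal entries. -/
open Matrix

/-- Membership in `Δ̲(n,r)`. -/
def InUDelta (n r : ℕ) (X : Fin n → Matrix (Fin r) (Fin r) ℝ) : Prop :=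
  (∀ i, (X i).PosSemidef) ∧ (∑ i, (X i).trace) = 1 ∧ ∀ i k l, RatDen r (X i k l)

/-- The Gram matrix `(Tr(X_i X_j))_{i,j}` of a tuple of matrices. -/
def gramMat {n r : ℕ} (X : Fin n → Matrix (Fin r) (Fin r) ℝ) : Matrix (Fin n) (Fin n) ℝ :=
  Matrix.of fun i j => (X i * X j).trace

/-- The cone `C_r^n`. -/
def InC (n r : ℕ) (A : Matrix (Fin n) (Fin n) ℝ) : Prop :=
  ∃ (m : ℕ) (c : Fin m → ℝ) (X : Fin m → Fin n → Matrix (Fin r) (Fin r) ℝ),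
    (∀ k, 0 ≤ c k) ∧ (∀ k, InUDelta n r (X k)) ∧ A = ∑ k, c k • gramMat (X k)

theorem gramMat_one_apply {n : ℕ} (X : Fin n → Matrix (Fin 1) (Fin 1) ℝ) (i j : Fin n) :
    gramMat X i j = X i 0 0 * X j 0 0 := by
  simp [gramMat, Matrix.trace, Matrix.mul_apply]

/-- Nonnegative integers with sum `1` have pairwise zero products. -/
theorem mul_eq_zero_of_sum_eq_one {ι : Type*} [Fintype ι] {p : ι → ℤ} (hp : ∀ i, 0 ≤ p i)
    (hsum : ∑ i, p i = 1) {i j : ι} (hij : i ≠ j) : p i * p j = 0 := by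
  have hle : p i + p j ≤ 1 := hsum ▸
    Finset.add_le_sum (fun k _ => hp k) (Finset.mem_univ i) (Finset.mem_univ j) hij
  have hi := hp i
  have hj := hp j
  rcases hi.eq_or_lt with h | h
  · simp [← h]
  · have : p j = 0 := by omega
    simp [this]

theorem InUDelta.gramMat_apply_eq_zero {n : ℕ} {X : Fin n → Matrix (Fin 1) (Fin 1) ℝ}
    (hX : InUDelta n 1 X) {i j : Fin n} (hij : i ≠ j) : gramMat X i j = 0 := by
  obtain ⟨hpos, hsum, hrat⟩ := hX
  have hint : ∀ i, ∃ p : ℤ, X i 0 0 = p := fun i => by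
    obtain ⟨p, q, hq, hq', h⟩ := hrat i 0 0
    obtain rfl : q = 1 := le_antisymm hq' hq
    exact ⟨p, by simpa using h⟩
  choose p hp using hint
  have hp0 : ∀ i, 0 ≤ p i := fun i => by
    have h : 0 ≤ X i 0 0 := (hpos i).diag_nonneg
    rw [hp i] at h
    exact_mod_cast h
  have hp1 : ∑ i, p i = 1 := by
    simp only [Matrix.trace, Matrix.diag_apply, Fin.sum_univ_one, hp] at hsum
    exact_mod_cast hsum
  rw [gramMat_one_apply, hp, hp]
  exact_mod_cast mul_eq_zero_of_sum_eq_one hp0 hp1 hij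

theorem inUDelta_single {n : ℕ} (k : Fin n) :
    InUDelta n 1 (Pi.single k (1 : Matrix (Fin 1) (Fin 1) ℝ)) := by
  refine ⟨fun i => ?_, ?_, fun i a b => ?_⟩
  · rcases eq_or_ne i k with rfl | h
    · simpa using Matrix.PosSemidef.one
    · simpa [h] using Matrix.PosSemidef.zero
  · rw [Finset.sum_eq_single k] <;> simp +contextual
  · obtain rfl : a = b := Subsingleton.elim a b
    rcases eq_or_ne i k with rfl | h
    · exact ⟨1, 1, le_rfl, le_rfl, by simp⟩
    · exact ⟨0, 1, le_rfl, le_rfl, by simp [h]⟩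

theorem gramMat_single {n : ℕ} (k : Fin n) :
    gramMat (Pi.single k (1 : Matrix (Fin 1) (Fin 1) ℝ)) =
      Matrix.diagonal (Pi.single k (1 : ℝ)) := by
  ext i j
  rw [gramMat_one_apply, Matrix.diagonal_apply]
  by_cases hi : i = k <;> by_cases hj : j = k <;> simp_all [eq_comm]

/-- `C_1^n` is exactly the set of diagonal matrices with nonnegative diagonal entries. -/
theorem stmt18 (n : ℕ) (hn : 1 ≤ n) :
    {A : Matrix (Fin n) (Fin n) ℝ | InC n 1 A} =
    {A : Matrix (Fin n) (Fin n) ℝ |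
      ∃ d : Fin n → ℝ, (∀ i, 0 ≤ d i) ∧ A = Matrix.diagonal d} := by
  ext A
  constructor
  · rintro ⟨m, c, X, hc, hX, rfl⟩
    refine ⟨fun i => ∑ k, c k * (X k i 0 0 * X k i 0 0), fun i =>
      Finset.sum_nonneg fun k _ => mul_nonneg (hc k) (mul_self_nonneg _), ?_⟩
    ext i j
    rcases eq_or_ne i j with rfl | hij
    · simp [Matrix.sum_apply, gramMat_one_apply]
    · simp [Matrix.sum_apply, (hX _).gramMat_apply_eq_zero hij, hij]
  · rintro ⟨d, hd, rfl⟩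
    refine ⟨n, d, fun k => Pi.single k 1, hd, inUDelta_single, ?_⟩
    ext i j
    simp only [gramMat_single, Matrix.sum_apply, Matrix.smul_apply, Matrix.diagonal_apply]
    rcases eq_or_ne i j with rfl | hij
    · simp [Pi.single_apply]
    · simp [hij]
end

section
/- For every n ≥ 1, the cone C_2^n equals the set of all finite nonnegative linear combinations of the matrices E_ii (i ∈ [n]) and E_ii + E_ij + E_jj (i ≠ j ∈ [n]), where E_ij denotes the symmetric elementary matrix with entry 1 in positions (i,j) and (j,i) and 0 elsewhere. -/
open Matrix

/-- The symmetric elementary matrix `E_ij`, with entry `1` in positions `(i,j)` and `(j,i)`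
and `0` elsewhere. -/
def Esym (n : ℕ) (i j : Fin n) : Matrix (Fin n) (Fin n) ℝ :=
  Matrix.of fun k l => if (k = i ∧ l = j) ∨ (k = j ∧ l = i) then 1 else 0

/-- The generating set for `C_2^n`: the matrices `E_ii` and `E_ii + E_ij + E_jj` (`i ≠ j`). -/
def GenSet (n : ℕ) : Set (Matrix (Fin n) (Fin n) ℝ) :=
  {B | ∃ i : Fin n, B = Esym n i i} ∪
  {B | ∃ i j : Fin n, i ≠ j ∧ B = Esym n i i + Esym n i j + Esym n j j}

open scoped NNReal

/-- Finite nonnegative combinations of elements of `S` form the `ℝ≥0`-span of `S`. -/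
theorem exists_nonneg_combination_iff_mem_span {M : Type*} [AddCommGroup M] [Module ℝ M]
    (S : Set M) (A : M) :
    (∃ (m : ℕ) (c : Fin m → ℝ) (B : Fin m → M),
      (∀ k, 0 ≤ c k) ∧ (∀ k, B k ∈ S) ∧ A = ∑ k, c k • B k) ↔ A ∈ Submodule.span ℝ≥0 S := by
  constructor
  · rintro ⟨m, c, B, hc, hB, rfl⟩
    exact Submodule.sum_mem _ fun k _ =>
      Submodule.smul_mem _ (⟨c k, hc k⟩ : ℝ≥0) (Submodule.subset_span (hB k))
  · intro h
    obtain ⟨m, f, g, rfl⟩ := Submodule.mem_span_set'.1 h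
    exact ⟨m, fun k => f k, fun k => g k, fun k => (f k).2, fun k => (g k).2, rfl⟩

theorem inC_iff_mem_span (n r : ℕ) (A : Matrix (Fin n) (Fin n) ℝ) :
    InC n r A ↔ A ∈ Submodule.span ℝ≥0 (gramMat '' {X | InUDelta n r X}) := by
  rw [← exists_nonneg_combination_iff_mem_span]
  constructor
  · rintro ⟨m, c, X, hc, hX, rfl⟩
    exact ⟨m, c, fun k => gramMat (X k), hc, fun k => ⟨X k, hX k, rfl⟩, rfl⟩
  · rintro ⟨m, c, B, hc, hB, rfl⟩
    choose X hX hXB using hB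
    exact ⟨m, c, X, hc, hX, by simp only [hXB]⟩

theorem RatDen.exists_two_mul_eq {x : ℝ} (h : RatDen 2 x) : ∃ z : ℤ, 2 * x = z := by
  obtain ⟨p, q, h1, h2, rfl⟩ := h
  interval_cases q
  · exact ⟨2 * p, by push_cast; ring⟩
  · exact ⟨p, by push_cast; ring⟩

/-- A half-integral positive semidefinite `2 × 2` matrix of trace `1/2` is half of a diagonal
matrix unit. -/
theorem eq_single_of_trace_eq_half {X : Matrix (Fin 2) (Fin 2) ℝ} (hX : X.PosSemidef)
    (hr : ∀ k l, RatDen 2 (X k l)) (ht : X.trace = 1 / 2) :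
    ∃ k, X = Matrix.single k k (1 / 2) := by
  obtain ⟨a, ha⟩ := (hr 0 0).exists_two_mul_eq
  obtain ⟨b, hb⟩ := (hr 1 1).exists_two_mul_eq
  have h0 : 0 ≤ X 0 0 := hX.diag_nonneg
  have h1 : 0 ≤ X 1 1 := hX.diag_nonneg
  have hs : X 1 0 = X 0 1 := by simpa using hX.isHermitian.apply 0 1
  have hd := hX.det_nonneg
  rw [Matrix.det_fin_two, hs] at hd
  rw [Matrix.trace_fin_two] at ht
  have ha0 : 0 ≤ a := by exact_mod_cast (by linarith : (0 : ℝ) ≤ a)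
  have hb0 : 0 ≤ b := by exact_mod_cast (by linarith : (0 : ℝ) ≤ b)
  have hab : a + b = 1 := by exact_mod_cast (by linarith : (a : ℝ) + b = 1)
  obtain h | h : a = 0 ∨ b = 0 := by omega
  · have e0 : X 0 0 = 0 := by simpa [h] using ha
    have e1 : X 1 1 = 1 / 2 := by linarith
    have e : X 0 1 = 0 := by rw [e0] at hd; nlinarith
    exact ⟨1, by ext k l; fin_cases k <;> fin_cases l <;> simp [Matrix.single, *]⟩
  · have e1 : X 1 1 = 0 := by simpa [h] using hb
    have e0 : X 0 0 = 1 / 2 := by linarith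
    have e : X 0 1 = 0 := by rw [e1] at hd; nlinarith
    exact ⟨0, by ext k l; fin_cases k <;> fin_cases l <;> simp [Matrix.single, *]⟩

theorem Finset.sum_eq_two_cases {ι : Type*} [Fintype ι] [DecidableEq ι] {u : ι → ℕ}
    (h : ∑ i, u i = 2) :
    (∃ i, ∀ k, k ≠ i → u k = 0) ∨
      ∃ i j, i ≠ j ∧ u i = 1 ∧ u j = 1 ∧ ∀ k, k ≠ i → k ≠ j → u k = 0 := by
  obtain ⟨i, -, hi⟩ := Finset.exists_ne_zero_of_sum_ne_zero (h.trans_ne two_ne_zero)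
  have hsum := Finset.add_sum_erase Finset.univ u (Finset.mem_univ i)
  by_cases hz : ∑ k ∈ Finset.univ.erase i, u k = 0
  · exact .inl ⟨i, fun k hk => Finset.sum_eq_zero_iff.1 hz k (by simp [hk])⟩
  · obtain ⟨j, hj, hj0⟩ := Finset.exists_ne_zero_of_sum_ne_zero hz
    have hsum' := Finset.add_sum_erase _ u hj
    have hz' : ∑ k ∈ (Finset.univ.erase i).erase j, u k = 0 := by omega
    exact .inr ⟨i, j, (Finset.ne_of_mem_erase hj).symm, by omega, by omega,
      fun k hki hkj => Finset.sum_eq_zero_iff.1 hz' k (by simp [hki, hkj])⟩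

theorem InUDelta.exists_natCast_eq_two_mul_trace {n : ℕ}
    {X : Fin n → Matrix (Fin 2) (Fin 2) ℝ} (hX : InUDelta n 2 X) (i : Fin n) :
    ∃ u : ℕ, 2 * (X i).trace = u := by
  obtain ⟨a, ha⟩ := (hX.2.2 i 0 0).exists_two_mul_eq
  obtain ⟨b, hb⟩ := (hX.2.2 i 1 1).exists_two_mul_eq
  have h : 2 * (X i).trace = ((a + b : ℤ) : ℝ) := by
    rw [Matrix.trace_fin_two]; push_cast; linarith
  have h0 : 0 ≤ a + b := by
    have := (hX.1 i).trace_nonneg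
    exact_mod_cast (by linarith : (0 : ℝ) ≤ ((a + b : ℤ) : ℝ))
  lift a + b to ℕ using h0 with u
  exact ⟨u, by simpa using h⟩

theorem Esym_self_mem_span {n : ℕ} (i : Fin n) :
    Esym n i i ∈ Submodule.span ℝ≥0 (GenSet n) :=
  Submodule.subset_span (.inl ⟨i, rfl⟩)

theorem gramMat_mem_span_genSet {n : ℕ} {X : Fin n → Matrix (Fin 2) (Fin 2) ℝ}
    (hX : InUDelta n 2 X) : gramMat X ∈ Submodule.span ℝ≥0 (GenSet n) := by
  choose u hu using hX.exists_natCast_eq_two_mul_trace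
  have hsum : ∑ i, u i = 2 := by
    have : ((∑ i, u i : ℕ) : ℝ) = 2 := by
      push_cast
      simp only [← hu, ← Finset.mul_sum, hX.2.1, mul_one]
    exact_mod_cast this
  have hzero : ∀ k, u k = 0 → X k = 0 := fun k hk =>
    (hX.1 k).trace_eq_zero_iff.1 (by simpa [hk] using hu k)
  have hhalf : ∀ k, u k = 1 → ∃ l, X k = Matrix.single l l (1 / 2) := fun k hk =>
    eq_single_of_trace_eq_half (hX.1 k) (hX.2.2 k) <| by
      have := hu k
      rw [hk, Nat.cast_one] at this
      linarith
  obtain ⟨i, hi⟩ | ⟨i, j, hij, hi, hj, hk⟩ := Finset.sum_eq_two_cases hsum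
  · have h0 : 0 ≤ (X i * X i).trace := by
      have := (Matrix.posSemidef_conjTranspose_mul_self (X i)).trace_nonneg
      rwa [(hX.1 i).isHermitian.eq] at this
    have : gramMat X = (⟨_, h0⟩ : ℝ≥0) • Esym n i i := by
      ext a b
      change (X a * X b).trace = (X i * X i).trace * Esym n i i a b
      by_cases ha : a = i
      · by_cases hb : b = i
        · simp [Esym, ha, hb]
        · simp [Esym, hb, hzero b (hi b hb)]
      · simp [Esym, ha, hzero a (hi a ha)]
    rw [this]
    exact Submodule.smul_mem _ _ (Esym_self_mem_span i)
  · obtain ⟨p, hp⟩ := hhalf i hi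
    obtain ⟨q, hq⟩ := hhalf j hj
    have hout : ∀ k, k ≠ i → k ≠ j → X k = 0 := fun k h1 h2 => hzero k (hk k h1 h2)
    have hji := hij.symm
    by_cases hpq : p = q
    · have : gramMat X = (1 / 4 : ℝ≥0) • (Esym n i i + Esym n i j + Esym n j j) := by
        ext a b
        change (X a * X b).trace = (1 / 4 : ℝ) * (Esym n i i a b + Esym n i j a b + Esym n j j a b)
        by_cases ha : a = i <;> by_cases ha' : a = j <;> by_cases hb : b = i <;>
          by_cases hb' : b = j <;> simp_all [Esym] <;> norm_num
      rw [this]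
      exact Submodule.smul_mem _ _ (Submodule.subset_span (.inr ⟨i, j, hij, rfl⟩))
    · have hqp := Ne.symm hpq
      have : gramMat X = (1 / 4 : ℝ≥0) • (Esym n i i + Esym n j j) := by
        ext a b
        change (X a * X b).trace = (1 / 4 : ℝ) * (Esym n i i a b + Esym n j j a b)
        by_cases ha : a = i <;> by_cases ha' : a = j <;> by_cases hb : b = i <;>
          by_cases hb' : b = j <;> simp_all [Esym] <;> norm_num
      rw [this]
      exact Submodule.smul_mem _ _
        (Submodule.add_mem _ (Esym_self_mem_span i) (Esym_self_mem_span j))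

/-- Rank-one tuples supported on a single diagonal matrix unit realize `w wᵀ`. -/
theorem vecMulVec_mem_image_gramMat {n : ℕ} {w : Fin n → ℝ} (h0 : ∀ i, 0 ≤ w i)
    (h1 : ∑ i, w i = 1) (hr : ∀ i, RatDen 2 (w i)) :
    Matrix.vecMulVec w w ∈ gramMat '' {X | InUDelta n 2 X} := by
  refine ⟨fun i => Matrix.single 0 0 (w i), ⟨fun i => ?_, ?_, fun i k l => ?_⟩, ?_⟩
  · beta_reduce
    rw [← Matrix.diagonal_single]
    exact Matrix.PosSemidef.diagonal (Pi.single_nonneg.2 (h0 i))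
  · simpa using h1
  · change RatDen 2 (Matrix.single 0 0 (w i) k l)
    rw [Matrix.single_apply]
    split_ifs
    · exact hr i
    · exact ⟨0, 1, by norm_num, by norm_num, by simp⟩
  · ext a b
    simp [gramMat, Matrix.vecMulVec_apply]

theorem genSet_subset_span_gramMat (n : ℕ) :
    GenSet n ⊆ Submodule.span ℝ≥0 (gramMat '' {X | InUDelta n 2 X}) := by
  rintro _ (⟨i, rfl⟩ | ⟨i, j, hij, rfl⟩)
  · have hE : Esym n i i = Matrix.vecMulVec (Pi.single i 1) (Pi.single i 1) := by
      ext a b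
      by_cases ha : a = i <;> by_cases hb : b = i <;>
        simp [Esym, Matrix.vecMulVec_apply, ha, hb]
    rw [hE]
    refine Submodule.subset_span (vecMulVec_mem_image_gramMat (fun k => ?_) (by simp) fun k => ?_)
    · rw [Pi.single_apply]; split_ifs <;> norm_num
    · rw [Pi.single_apply]
      split_ifs
      · exact ⟨1, 1, by norm_num, by norm_num, by simp⟩
      · exact ⟨0, 1, by norm_num, by norm_num, by simp⟩
  · have hji := hij.symm
    set w : Fin n → ℝ := fun k => if k = i ∨ k = j then 1 / 2 else 0 with hw
    have hE : Esym n i i + Esym n i j + Esym n j j = (4 : ℝ≥0) • Matrix.vecMulVec w w := by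
      ext a b
      change Esym n i i a b + Esym n i j a b + Esym n j j a b = (4 : ℝ) * (w a * w b)
      by_cases ha : a = i <;> by_cases ha' : a = j <;> by_cases hb : b = i <;>
        by_cases hb' : b = j <;> simp_all [Esym] <;> norm_num
    rw [hE]
    refine Submodule.smul_mem _ _
      (Submodule.subset_span (vecMulVec_mem_image_gramMat (fun k => ?_) ?_ fun k => ?_))
    · simp only [hw]; split_ifs <;> norm_num
    · have : (Finset.univ.filter fun k => k = i ∨ k = j) = {i, j} := by ext; simp
      rw [hw, ← Finset.sum_filter, this, Finset.sum_pair hij]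
      norm_num
    · simp only [hw]
      split_ifs
      · exact ⟨1, 2, by norm_num, by norm_num, by simp⟩
      · exact ⟨0, 1, by norm_num, by norm_num, by simp⟩

/-- `C_2^n` equals the set of finite nonnegative linear combinations of the matrices `E_ii`
and `E_ii + E_ij + E_jj` for `i ≠ j`. -/
theorem stmt19 (n : ℕ) (hn : 1 ≤ n) :
    {A : Matrix (Fin n) (Fin n) ℝ | InC n 2 A} =
    {A : Matrix (Fin n) (Fin n) ℝ |
      ∃ (m : ℕ) (c : Fin m → ℝ) (B : Fin m → Matrix (Fin n) (Fin n) ℝ),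
        (∀ k, 0 ≤ c k) ∧ (∀ k, B k ∈ GenSet n) ∧ A = ∑ k, c k • B k} := by
  ext A
  simp only [Set.mem_ofPred_eq]
  rw [inC_iff_mem_span, exists_nonneg_combination_iff_mem_span]
  constructor
  · intro h
    exact Submodule.span_le.2 (by rintro _ ⟨X, hX, rfl⟩; exact gramMat_mem_span_genSet hX) h
  · intro h
    exact Submodule.span_le.2 (genSet_subset_span_gramMat n) h
end
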